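/- Let 1 < α ≤ 2, 0 ≤ β < α - 1, a < b, q : [a,b] → ℝ continuous, and let G be the Green's function of the fractional BVP. If u is continuous on [a,b], u(t) > 0 on (a,b), u not identically zero, with m = max u over [a,b], and u(t) = ∫ₐᵇ G(t,s) q(s) u(s) ds, then m < m · ∫ₐᵇ G(s,s) max(q(s),0) ds. -/

import Mathlib

noncomputable def G (a b α β t s : ℝ) : ℝ :=
  if s ≤ t then
    (1 / Real.Gamma α) *
      ((t - a) ^ (α - 1) * (b - s) ^ (α - 1 - β) / (b - a) ^ (α - 1 - β) -
        (t - s) ^ (α - 1))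
  else
    (1 / Real.Gamma α) *
      ((t - a) ^ (α - 1) * (b - s) ^ (α - 1 - β) / (b - a) ^ (α - 1 - β))

theorem G_eq_sub_rpow_max {a b α β t s : ℝ} (hα : 1 < α) :
    G a b α β t s = (1 / Real.Gamma α) *
      ((t - a) ^ (α - 1) * (b - s) ^ (α - 1 - β) / (b - a) ^ (α - 1 - β) -
        (max (t - s) 0) ^ (α - 1)) := by
  unfold G
  split_ifs with h
  · rw [max_eq_left (by linarith)]
  · rw [max_eq_right (by linarith), Real.zero_rpow (by linarith), sub_zero]

theorem G_self {a b α β s : ℝ} (hα : 1 < α) :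
    G a b α β s s = (1 / Real.Gamma α) *
      ((s - a) ^ (α - 1) * (b - s) ^ (α - 1 - β) / (b - a) ^ (α - 1 - β)) := by
  simp [G, Real.zero_rpow (show α - 1 ≠ 0 by linarith)]

theorem continuous_G_right {a b α β : ℝ} (t : ℝ) (hα : 1 < α) (hβα : β < α - 1) :
    Continuous fun s => G a b α β t s := by
  simp only [G_eq_sub_rpow_max hα]
  have h1 : Continuous fun s : ℝ => (b - s) ^ (α - 1 - β) :=
    (continuous_const.sub continuous_id).rpow_const fun _ => Or.inr (by linarith)
  have h2 : Continuous fun s : ℝ => (max (t - s) 0) ^ (α - 1) :=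
    ((continuous_const.sub continuous_id).max continuous_const).rpow_const
      fun _ => Or.inr (by linarith)
  fun_prop

theorem continuous_G_self {a b α β : ℝ} (hα : 1 < α) (hβα : β < α - 1) :
    Continuous fun s => G a b α β s s := by
  simp only [G_self hα]
  have h1 : Continuous fun s : ℝ => (b - s) ^ (α - 1 - β) :=
    (continuous_const.sub continuous_id).rpow_const fun _ => Or.inr (by linarith)
  have h2 : Continuous fun s : ℝ => (s - a) ^ (α - 1) :=
    (continuous_id.sub continuous_const).rpow_const fun _ => Or.inr (by linarith)
  fun_prop

theorem G_right_endpoint {a b α β t : ℝ} (hα : 1 < α) (hβα : β < α - 1) (ht : t ≤ b) :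
    G a b α β t b = 0 := by
  rw [G_eq_sub_rpow_max hα, max_eq_right (by linarith), sub_self,
    Real.zero_rpow (by linarith), Real.zero_rpow (by linarith)]
  simp

theorem G_nonneg {a b α β t s : ℝ} (hα : 1 < α) (hβ : 0 ≤ β)
    (ht : t ∈ Set.Icc a b) (hs : s ∈ Set.Ioo a b) : 0 ≤ G a b α β t s := by
  obtain ⟨hat, htb⟩ := ht
  obtain ⟨has, hsb⟩ := hs
  have hΓ : 0 < Real.Gamma α := Real.Gamma_pos_of_pos (by linarith)
  have hba : 0 < b - a := by linarith
  have hbs : 0 < b - s := by linarith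
  have hta : 0 ≤ t - a := by linarith
  rw [G]
  split_ifs with h
  · refine mul_nonneg (by positivity) (sub_nonneg.2 ?_)
    rw [mul_div_assoc, ← Real.div_rpow hbs.le hba.le]
    calc (t - s) ^ (α - 1) ≤ ((t - a) * ((b - s) / (b - a))) ^ (α - 1) := by
          refine Real.rpow_le_rpow (by linarith) ?_ (by linarith)
          rw [← mul_div_assoc, le_div_iff₀ hba]
          nlinarith [mul_nonneg (sub_nonneg.2 has.le) (sub_nonneg.2 htb)]
      _ = (t - a) ^ (α - 1) * ((b - s) / (b - a)) ^ (α - 1) :=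
          Real.mul_rpow hta (by positivity)
      _ ≤ (t - a) ^ (α - 1) * ((b - s) / (b - a)) ^ (α - 1 - β) := by
          refine mul_le_mul_of_nonneg_left ?_ (by positivity)
          exact Real.rpow_le_rpow_of_exponent_ge (by positivity)
            ((div_le_one hba).2 (by linarith)) (by linarith)
  · positivity

theorem G_lt_G_self {a b α β t s : ℝ} (hα : 1 < α) (hα2 : α ≤ 2) (hβα : β < α - 1)
    (ht : t ∈ Set.Icc a b) (hs : s ∈ Set.Ioo a b) (hne : s ≠ t) :
    G a b α β t s < G a b α β s s := by
  obtain ⟨hat, htb⟩ := ht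
  obtain ⟨has, hsb⟩ := hs
  have hΓ : 0 < Real.Gamma α := Real.Gamma_pos_of_pos (by linarith)
  have hba : 0 < b - a := by linarith
  have hbs : 0 < b - s := by linarith
  have hK : 0 < ((b - s) / (b - a)) ^ (α - 1 - β) := by positivity
  rw [G_self hα, G]
  split_ifs with h
  · have hts : 0 < t - s := sub_pos.2 (lt_of_le_of_ne h hne)
    refine mul_lt_mul_of_pos_left ?_ (by positivity)
    rw [mul_div_assoc, mul_div_assoc, ← Real.div_rpow hbs.le hba.le]
    have hK1 : ((b - s) / (b - a)) ^ (α - 1 - β) < 1 :=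
      Real.rpow_lt_one (by positivity) ((div_lt_one hba).2 (by linarith)) (by linarith)
    have hsub : (t - a) ^ (α - 1) ≤ (t - s) ^ (α - 1) + (s - a) ^ (α - 1) := by
      have := Real.rpow_add_le_add_rpow hts.le (sub_nonneg.2 has.le)
        (show 0 ≤ α - 1 by linarith) (by linarith)
      rwa [sub_add_sub_cancel] at this
    have hpos : 0 < (t - s) ^ (α - 1) := by positivity
    nlinarith [mul_le_mul_of_nonneg_right hsub hK.le, mul_lt_mul_of_pos_left hK1 hpos]
  · refine mul_lt_mul_of_pos_left ?_ (by positivity)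
    rw [mul_div_assoc, mul_div_assoc, ← Real.div_rpow hbs.le hba.le]
    exact mul_lt_mul_of_pos_right
      (Real.rpow_lt_rpow (by linarith) (by linarith) (by linarith)) hK

theorem stmt_19 (α β a b m : ℝ) (hα : 1 < α) (hα2 : α ≤ 2) (hβ : 0 ≤ β)
    (hβα : β < α - 1) (hab : a < b) (q u : ℝ → ℝ)
    (hq : ContinuousOn q (Set.Icc a b))
    (hu : ContinuousOn u (Set.Icc a b))
    (hpos : ∀ t ∈ Set.Ioo a b, 0 < u t)
    (hne : ∃ t ∈ Set.Icc a b, u t ≠ 0)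
    (hm : ∃ t₀ ∈ Set.Icc a b, u t₀ = m ∧ ∀ t ∈ Set.Icc a b, u t ≤ m)
    (heq : ∀ t ∈ Set.Icc a b, u t = ∫ s in a..b, G a b α β t s * (q s * u s)) :
    m < m * ∫ s in a..b, G a b α β s s * max (q s) 0 := by
  obtain ⟨t₀, ht₀, hut₀, hum⟩ := hm
  have hm0 : 0 < m := by
    have hmid : (a + b) / 2 ∈ Set.Ioo a b := ⟨by linarith, by linarith⟩
    exact (hpos _ hmid).trans_le (hum _ (Set.Ioo_subset_Icc_self hmid))
  have hcl : ContinuousOn (fun s => G a b α β t₀ s * (q s * u s)) (Set.Icc a b) :=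
    (continuous_G_right t₀ hα hβα).continuousOn.mul (hq.mul hu)
  have hcr : ContinuousOn (fun s => m * (G a b α β s s * max (q s) 0)) (Set.Icc a b) :=
    continuousOn_const.mul
      ((continuous_G_self hα hβα).continuousOn.mul (hq.sup continuousOn_const))
  have hle_self : ∀ s ∈ Set.Ioo a b, G a b α β t₀ s ≤ G a b α β s s := by
    intro s hs
    rcases eq_or_ne s t₀ with rfl | hst
    · exact le_rfl
    · exact (G_lt_G_self hα hα2 hβα ht₀ hs hst).le
  have hintegrand : ∀ s ∈ Set.Ioc a b,
      G a b α β t₀ s * (q s * u s) ≤ m * (G a b α β s s * max (q s) 0) := by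
    rintro s ⟨has, hsb⟩
    rcases hsb.eq_or_lt with rfl | hsb
    · simp [G_right_endpoint hα hβα ht₀.2, G_right_endpoint hα hβα le_rfl]
    have hs : s ∈ Set.Ioo a b := ⟨has, hsb⟩
    have h0 := G_nonneg hα hβ ht₀ hs
    calc G a b α β t₀ s * (q s * u s) ≤ G a b α β s s * (max (q s) 0 * m) := by
          refine mul_le_mul_of_nonneg (hle_self s hs) ?_ h0
            (mul_nonneg (le_max_right _ _) hm0.le)
          exact (mul_le_mul_of_nonneg_right (le_max_left _ _) (hpos s hs).le).trans
            (mul_le_mul_of_nonneg_left (hum s ⟨has.le, hsb.le⟩) (le_max_right _ _))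
      _ = m * (G a b α β s s * max (q s) 0) := by ring
  have hq_pos : ∃ s ∈ Set.Ioo a b, 0 < q s := by
    by_contra! hcon
    have hle : ∫ s in a..b, G a b α β t₀ s * (q s * u s) ≤ ∫ _ in a..b, (0 : ℝ) := by
      refine intervalIntegral.integral_mono_on_of_le_Ioo hab.le
        (hcl.intervalIntegrable_of_Icc hab.le) intervalIntegrable_const fun s hs => ?_
      exact mul_nonpos_of_nonneg_of_nonpos (G_nonneg hα hβ ht₀ hs)
        (mul_nonpos_of_nonpos_of_nonneg (hcon s hs) (hpos s hs).le)
    rw [← heq t₀ ht₀, hut₀, intervalIntegral.integral_zero] at hle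
    linarith
  obtain ⟨s, hs, hsne, hqs⟩ : ∃ s ∈ Set.Ioo a b, s ≠ t₀ ∧ 0 < q s := by
    obtain ⟨s, hs, hqs⟩ := hq_pos
    rcases eq_or_ne s t₀ with rfl | hst
    · have hev : ∀ᶠ x in nhds s, x ∈ Set.Ioo a b ∧ 0 < q x :=
        Filter.Eventually.and (Ioo_mem_nhds hs.1 hs.2)
          ((hq.continuousAt (Icc_mem_nhds hs.1 hs.2)).eventually_const_lt hqs)
      obtain ⟨x, ⟨hx, hqx⟩, hxs⟩ :=
        ((hev.filter_mono nhdsWithin_le_nhds).and (self_mem_nhdsWithin (s := {s}ᶜ))).exists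
      exact ⟨x, hx, hxs, hqx⟩
    · exact ⟨s, hs, hst, hqs⟩
  have hlt := intervalIntegral.integral_lt_integral_of_continuousOn_of_le_of_exists_lt hab hcl hcr
    hintegrand ⟨s, Set.Ioo_subset_Icc_self hs, by
      rw [max_eq_left hqs.le]
      calc G a b α β t₀ s * (q s * u s) < G a b α β s s * (q s * u s) :=
            mul_lt_mul_of_pos_right (G_lt_G_self hα hα2 hβα ht₀ hs hsne)
              (mul_pos hqs (hpos s hs))
        _ ≤ G a b α β s s * (q s * m) :=
            mul_le_mul_of_nonneg_left
              (mul_le_mul_of_nonneg_left (hum s (Set.Ioo_subset_Icc_self hs)) hqs.le)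
              ((G_nonneg hα hβ ht₀ hs).trans (hle_self s hs))
        _ = m * (G a b α β s s * q s) := by ring⟩
  rwa [← heq t₀ ht₀, hut₀, intervalIntegral.integral_const_mul] at hlt
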